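/- arXiv:2401.00358 — 2 statements merged into one kernel-verified Lean document; each statement's English description precedes it below -/
import Mathlib

section
/- Fix a positive integer r. There exist constants A > 0 and X_0 such that for all X ≥ X_0 and all Z with (log X)^{max{3, 2r}} ≤ Z ≤ X^{1/2}, setting U := log X / log Z: #{n ≤ X : P(n) ≤ Z and n is r-full} ≤ A · X^{1/r} (log Z) · exp(−(U/r) log U + A·U·log log(3U)). -/
open Polynomial
open scoped Classical

noncomputable section

/-- `f : ℕ → ℤ` is a multiplicative arithmetic function. -/
def IsMultFn (f : ℕ → ℤ) : Prop :=
  f 1 = 1 ∧ ∀ m n : ℕ, Nat.Coprime m n → f (m * n) = f m * f n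

/-- The polynomials `F i` are multiplicatively independent over `ℤ`:
no nonzero integer tuple `c` makes `∏ i, (F i) ^ (c i)` identically constant in `ℚ(T)`. -/
def MultIndep {m : ℕ} (F : Fin m → Polynomial ℤ) : Prop :=
  ¬ ∃ c : Fin m → ℤ, c ≠ 0 ∧ ∃ r : ℚ,
      (∏ i, (algebraMap (Polynomial ℚ) (RatFunc ℚ) ((F i).map (Int.castRingHom ℚ))) ^ (c i))
        = algebraMap ℚ (RatFunc ℚ) r

/-- `β` is the last invariant factor of the exponent matrix of the family `F`
(for some factorization of the `F i` into pairwise non-associated primitive irreducibles,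
via a Smith normal form of the exponent matrix). -/
def IsLastInvFactor {m : ℕ} (F : Fin m → Polynomial ℤ) (β : ℤ) : Prop :=
  ∃ (M : ℕ) (G : Fin M → Polynomial ℤ) (c : Fin m → ℤ) (μ : Fin M → Fin m → ℕ),
    (∀ j, Irreducible (G j)) ∧
    (∀ j, (G j).IsPrimitive) ∧
    (∀ j j', j ≠ j' → ¬ Associated (G j) (G j')) ∧
    (∀ i, F i = Polynomial.C (c i) * ∏ j, G j ^ μ j i) ∧
    (∀ j, ∃ i, 0 < μ j i) ∧
    ∃ (P : Matrix (Fin M) (Fin M) ℤ) (Q : Matrix (Fin m) (Fin m) ℤ),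
      IsUnit P.det ∧ IsUnit Q.det ∧
      (∀ (s : Fin M) (t : Fin m), (s : ℕ) ≠ (t : ℕ) →
        (P * (Matrix.of fun u v => (μ u v : ℤ)) * Q) s t = 0) ∧
      (∀ (s s' : Fin M) (t t' : Fin m), (s : ℕ) = (t : ℕ) → (s' : ℕ) = (t' : ℕ) →
        (s : ℕ) + 1 = (s' : ℕ) →
        (P * (Matrix.of fun u v => (μ u v : ℤ)) * Q) s t ∣
          (P * (Matrix.of fun u v => (μ u v : ℤ)) * Q) s' t') ∧
      (∀ (s : Fin M) (t : Fin m), (s : ℕ) = (t : ℕ) → (s : ℕ) + 1 = min M m →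
        β = (P * (Matrix.of fun u v => (μ u v : ℤ)) * Q) s t)

/-- Invariant Factor Hypothesis `IFH(F; B₀)` for the modulus `q`. -/
def IFH {m : ℕ} (F : Fin m → Polynomial ℤ) (B₀ : ℝ) (q : ℕ) : Prop :=
  ∀ β : ℤ, IsLastInvFactor F β →
    ∀ ℓ : ℕ, ℓ.Prime → ℓ ∣ q → B₀ < (ℓ : ℝ) → Int.gcd ((ℓ : ℤ) - 1) β = 1

/-- `alphaRatio q P`: the proportion of units `u` mod `q` with `P(u)` a unit mod `q`. -/
def alphaRatio (q : ℕ) (P : Polynomial ℤ) : ℝ :=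
  (Nat.card {u : (ZMod q)ˣ // IsUnit (Polynomial.aeval ((u : ZMod q)) P)} : ℝ)
    / (Nat.totient q : ℝ)

/-- `q` is `k`-admissible with respect to the family of products `Wprod v`. -/
def KAdmissible (Wprod : ℕ → Polynomial ℤ) (k q : ℕ) : Prop :=
  (∃ u : (ZMod q)ˣ, IsUnit (Polynomial.aeval ((u : ZMod q)) (Wprod k))) ∧
  ∀ v, 1 ≤ v → v < k → ¬ ∃ u : (ZMod q)ˣ, IsUnit (Polynomial.aeval ((u : ZMod q)) (Wprod v))

/-- Narkiewicz's set `Q(k; f_1, …, f_K)`. -/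
def NarkSet {K : ℕ} (k : ℕ) (f : Fin K → ℕ → ℤ) (W : Fin K → ℕ → Polynomial ℤ) : Set ℕ :=
  {q | KAdmissible (fun v => ∏ i, W i v) k q ∧
    ∀ χ : Fin K → DirichletCharacter ℂ q, χ ≠ (fun _ => 1) →
      (∀ u : (ZMod q)ˣ, IsUnit (Polynomial.aeval ((u : ZMod q)) (∏ i, W i k)) →
          (∏ i, (χ i) (Polynomial.aeval ((u : ZMod q)) (W i k))) = 1) →
      ∃ p : ℕ, p.Prime ∧
        (∑' j : ℕ, (∏ i, (χ i) ((f i (p ^ j) : ZMod q))) *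
            ((((p : ℝ) ^ (-(j : ℝ) / (k : ℝ))) : ℝ) : ℂ)) = 0}

/-- `Pj j n`: the `j`-th largest prime factor of `n` counted with multiplicity,
equal to `1` if `Ω(n) < j`. -/
def Pj (j n : ℕ) : ℕ := (n.primeFactorsList.reverse).getD (j - 1) 1

/-- `nPart k n` is `n_k`, the largest positive integer whose `k`-th power is a
unitary divisor of `n`. -/
def nPart (k n : ℕ) : ℕ :=
  ∏ p ∈ n.primeFactors, if k ∣ n.factorization p then p ^ (n.factorization p / k) else 1

/-- A polynomial is squarefull in `ℤ[T]` iff every complex root has multiplicity at least 2. -/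
def SquarefullPoly (F : Polynomial ℤ) : Prop :=
  ∀ z : ℂ, (F.map (Int.castRingHom ℂ)).IsRoot z →
    2 ≤ (F.map (Int.castRingHom ℂ)).rootMultiplicity z

/-- `n` is convenient (with respect to exponent `k`, threshold `y` and length `J`). -/
def Convenient (k : ℕ) (y : ℝ) (J : ℕ) (n : ℕ) : Prop :=
  ∃ (m : ℕ) (P : Fin J → ℕ), 0 < m ∧ (∀ t, (P t).Prime) ∧
    (∀ s t : Fin J, s < t → P t < P s) ∧
    (∀ t, y < (P t : ℝ) ∧ Pj 1 m < P t) ∧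
    n = m * (∏ t, P t) ^ k

/-- The solution count `Ṽ_{N,K}(q; (w_i))`. -/
def VNK {K N : ℕ} (F : Fin K → Fin N → Polynomial ℤ) (q : ℕ) (w : Fin K → ZMod q) : ℕ :=
  Nat.card {v : Fin N → (ZMod q)ˣ //
    ∀ i, (∏ j, Polynomial.aeval ((v j : ZMod q)) (F i j)) = w i}

/-- `α*_N(q) = ∏_j α̃_j(q)`. -/
def alphaStarN {K N : ℕ} (F : Fin K → Fin N → Polynomial ℤ) (q : ℕ) : ℝ :=
  ∏ j, alphaRatio q (∏ i, F i j)

/-- `n` is `r`-full: every prime dividing `n` divides it to the `r`-th power. -/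
def IsRFull (r n : ℕ) : Prop := ∀ p : ℕ, p.Prime → p ∣ n → p ^ r ∣ n

/-- The `k`-free part of `n`. -/
def kfreePart (k n : ℕ) : ℕ :=
  ∏ p ∈ n.primeFactors, if n.factorization p < k then p ^ n.factorization p else 1

/-- An upper bound of Mertens type for `∑ (log p) / p` over primes `p ≤ N`. -/
theorem sum_primesLE_log_div_le {N : ℕ} (hN : 1 ≤ N) :
    ∑ p ∈ N.primesLE, Real.log p / p ≤ Real.log N + Real.log 4 := by
  have hN0 : (0 : ℝ) < N := by exact_mod_cast hN
  have h1 : ∑ n ∈ Finset.Ioc 0 N, ArithmeticFunction.vonMangoldt n * ((N / n : ℕ) : ℝ) =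
      ∑ n ∈ Finset.Ioc 0 N, Real.log n := by
    rw [← ArithmeticFunction.sum_Ioc_mul_zeta_eq_sum, ArithmeticFunction.vonMangoldt_mul_zeta]
    simp
  have h2 : ∑ n ∈ Finset.Ioc 0 N, Real.log n ≤ N * Real.log N := by
    have : ∀ n ∈ Finset.Ioc 0 N, Real.log n ≤ Real.log N := by
      intro n hn
      rw [Finset.mem_Ioc] at hn
      exact Real.log_le_log (by exact_mod_cast hn.1) (by exact_mod_cast hn.2)
    simpa using Finset.sum_le_card_nsmul _ _ _ this
  have h3 : ∑ p ∈ N.primesLE, Real.log p * ((N / p : ℕ) : ℝ) ≤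
      ∑ n ∈ Finset.Ioc 0 N, ArithmeticFunction.vonMangoldt n * ((N / n : ℕ) : ℝ) := by
    have hsub : N.primesLE ⊆ Finset.Ioc 0 N := by
      intro p hp
      rw [Nat.mem_primesLE] at hp
      exact Finset.mem_Ioc.2 ⟨hp.2.pos, hp.1⟩
    refine le_trans (le_of_eq ?_) (Finset.sum_le_sum_of_subset_of_nonneg hsub fun n _ _ =>
      mul_nonneg ArithmeticFunction.vonMangoldt_nonneg (Nat.cast_nonneg _))
    refine Finset.sum_congr rfl fun p hp => ?_
    rw [ArithmeticFunction.vonMangoldt_apply_prime (Nat.prime_of_mem_primesLE hp)]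
  have h4 : N * ∑ p ∈ N.primesLE, Real.log p / p - Chebyshev.theta N ≤
      ∑ p ∈ N.primesLE, Real.log p * ((N / p : ℕ) : ℝ) := by
    rw [Chebyshev.theta_eq_sum_primesLE_log, Finset.mul_sum, ← Finset.sum_sub_distrib]
    refine Finset.sum_le_sum fun p _ => ?_
    have := (Nat.sub_one_lt_floor ((N : ℝ) / p)).le
    rw [Nat.floor_div_eq_div] at this
    have := mul_le_mul_of_nonneg_left this (Real.log_natCast_nonneg p)
    calc _ = Real.log p * ((N : ℝ) / p - 1) := by ring
      _ ≤ _ := this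
  have h5 := Chebyshev.theta_le_log4_mul_x hN0.le
  refine le_of_mul_le_mul_left ?_ hN0
  linarith

theorem summable_natCast_rpow_neg {s : ℝ} (hs : 1 < s) :
    Summable fun n : ℕ => ((n : ℝ)) ^ (-s) :=
  Real.summable_nat_rpow.2 (by linarith)

theorem tsum_rpow_neg_le {s : ℝ} (hs : 1 < s) :
    ∑' n : ℕ, (n : ℝ) ^ (-s) ≤ 1 + 1 / (s - 1) := by
  have h := ZetaAsymptotics.zeta_limit_aux1 hs
  have h0 : 0 ≤ s * ZetaAsymptotics.termTSum s :=
    mul_nonneg (by linarith) (tsum_nonneg fun n => ZetaAsymptotics.term_nonneg _ _)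
  rw [(summable_natCast_rpow_neg hs).tsum_eq_zero_add]
  have h1 : ∀ n : ℕ, ((n + 1 : ℕ) : ℝ) ^ (-s) = 1 / ((n : ℝ) + 1) ^ s := by
    intro n
    rw [Real.rpow_neg (by positivity)]
    simp
  simp_rw [h1]
  rw [Nat.cast_zero, Real.zero_rpow (by linarith)]
  linarith

theorem exp_sum_primesLE_rpow_neg_le {s : ℝ} (hs : 1 < s) (N : ℕ) :
    Real.exp (∑ p ∈ N.primesLE, (p : ℝ) ^ (-s)) ≤ 1 + 1 / (s - 1) := by
  have hsum := summable_natCast_rpow_neg hs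
  have hE := EulerProduct.prod_primesBelow_tsum_eq_tsum_smoothNumbers
    (f := fun n : ℕ => (n : ℝ) ^ (-s)) (by simp)
    (fun {m n} _ => by
      simp only [Nat.cast_mul]
      rw [Real.mul_rpow (by positivity) (by positivity)]) (by simpa using hsum.norm) (N + 1)
  have hle := Summable.tsum_subtype_le (fun n : ℕ => (n : ℝ) ^ (-s)) (N + 1).smoothNumbers
    (fun n => by positivity) hsum
  refine le_trans ?_ (hle.trans (tsum_rpow_neg_le hs))
  rw [← hE, Real.exp_sum]
  refine Finset.prod_le_prod (fun _ _ => (Real.exp_pos _).le) fun p hp => ?_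
  have hp' : p.Prime := Nat.prime_of_mem_primesLE hp
  have hq0 : 0 ≤ (p : ℝ) ^ (-s) := by positivity
  have hq1 : (p : ℝ) ^ (-s) < 1 :=
    Real.rpow_lt_one_of_one_lt_of_neg (by exact_mod_cast hp'.one_lt) (by linarith)
  have : ∀ n : ℕ, ((p ^ n : ℕ) : ℝ) ^ (-s) = ((p : ℝ) ^ (-s)) ^ n := by
    intro n
    rw [Nat.cast_pow, ← Real.rpow_natCast, ← Real.rpow_natCast, ← Real.rpow_mul (by positivity),
      ← Real.rpow_mul (by positivity), mul_comm]
  simp_rw [this]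
  rw [tsum_geometric_of_lt_one hq0 hq1, le_inv_comm₀ (Real.exp_pos _) (by linarith),
    ← Real.exp_neg]
  linarith [Real.add_one_le_exp (-(p : ℝ) ^ (-s))]

theorem sum_primesLE_floor_log_div_le {z : ℝ} (hz : 1 ≤ z) :
    ∑ p ∈ ⌊z⌋₊.primesLE, Real.log p / p ≤ Real.log z + Real.log 4 := by
  have h1 : 1 ≤ ⌊z⌋₊ := Nat.one_le_floor_iff z |>.2 hz
  refine (sum_primesLE_log_div_le h1).trans ?_
  gcongr
  exact Nat.floor_le (by linarith)

theorem log_four_le : Real.log 4 ≤ 2 := by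
  have : Real.log 4 = 2 * Real.log 2 := by
    rw [show (4 : ℝ) = 2 ^ 2 by norm_num, Real.log_pow]; norm_num
  linarith [Real.log_two_lt_d9]

/-- An upper bound of Mertens type for `∑ 1 / p` over primes `p ≤ z`. -/
theorem exp_sum_primesLE_inv_le {z : ℝ} (hz : Real.exp 1 ≤ z) :
    Real.exp (∑ p ∈ ⌊z⌋₊.primesLE, (p : ℝ)⁻¹) ≤ 2 * Real.exp 3 * Real.log z := by
  have hz1 : 1 ≤ z := by linarith [Real.add_one_le_exp 1]
  have hl : 1 ≤ Real.log z := (Real.le_log_iff_exp_le (by linarith)).2 hz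
  set d : ℝ := 1 / Real.log z with hd
  have hd0 : 0 < d := by positivity
  have hE := exp_sum_primesLE_rpow_neg_le (s := 1 + d) (by linarith) ⌊z⌋₊
  have hM := sum_primesLE_floor_log_div_le hz1
  have key : ∑ p ∈ ⌊z⌋₊.primesLE, (p : ℝ)⁻¹ ≤
      ∑ p ∈ ⌊z⌋₊.primesLE, (p : ℝ) ^ (-(1 + d)) + 3 := by
    have h1 : ∑ p ∈ ⌊z⌋₊.primesLE, (p : ℝ)⁻¹ ≤
        ∑ p ∈ ⌊z⌋₊.primesLE, ((p : ℝ) ^ (-(1 + d)) + d * (Real.log p / p)) := by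
      refine Finset.sum_le_sum fun p hp => ?_
      have hp0 : (0 : ℝ) < p := by exact_mod_cast (Nat.prime_of_mem_primesLE hp).pos
      rw [neg_add, Real.rpow_add hp0, Real.rpow_neg_one, Real.rpow_def_of_pos hp0 (-d)]
      have := Real.add_one_le_exp (Real.log p * -d)
      have := mul_le_mul_of_nonneg_left this (inv_nonneg.2 hp0.le)
      rw [div_eq_mul_inv]
      linarith
    rw [Finset.sum_add_distrib, ← Finset.mul_sum] at h1
    have h2 : d * ∑ p ∈ ⌊z⌋₊.primesLE, Real.log p / p ≤ 3 := by
      refine (mul_le_mul_of_nonneg_left hM hd0.le).trans ?_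
      rw [hd, one_div, inv_mul_le_iff₀ (by linarith)]
      linarith [log_four_le]
    linarith
  calc _ ≤ Real.exp (∑ p ∈ ⌊z⌋₊.primesLE, (p : ℝ) ^ (-(1 + d)) + 3) := Real.exp_le_exp.2 key
    _ ≤ (1 + 1 / (1 + d - 1)) * Real.exp 3 := by
      rw [Real.exp_add]; gcongr
    _ = (1 + Real.log z) * Real.exp 3 := by rw [add_sub_cancel_left, hd, one_div_one_div]
    _ ≤ (2 * Real.log z) * Real.exp 3 := by gcongr; linarith
    _ = _ := by ring

/-- Weighted prime sum with a small positive shift `η` in the exponent. -/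
theorem sum_primesLE_rpow_le {z η : ℝ} (hz : Real.exp 1 ≤ z) :
    ∑ p ∈ ⌊z⌋₊.primesLE, (p : ℝ) ^ (η - 1) ≤
      ∑ p ∈ ⌊z⌋₊.primesLE, (p : ℝ)⁻¹ + 3 * Real.exp (η * Real.log z) := by
  have hz1 : 1 ≤ z := by linarith [Real.add_one_le_exp 1]
  have hl : 1 ≤ Real.log z := (Real.le_log_iff_exp_le (by linarith)).2 hz
  have hM := sum_primesLE_floor_log_div_le hz1
  set E := Real.exp (η * Real.log z) with hEdef
  have h1 : ∑ p ∈ ⌊z⌋₊.primesLE, (p : ℝ) ^ (η - 1) ≤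
      ∑ p ∈ ⌊z⌋₊.primesLE, ((p : ℝ)⁻¹ + E / Real.log z * (Real.log p / p)) := by
    refine Finset.sum_le_sum fun p hp => ?_
    have hp1 : (1 : ℝ) ≤ p := by exact_mod_cast (Nat.prime_of_mem_primesLE hp).one_le
    have hp0 : (0 : ℝ) < p := by linarith
    have hpz : (p : ℝ) ≤ z :=
      (Nat.cast_le.2 (Nat.le_of_mem_primesLE hp)).trans (Nat.floor_le (by linarith))
    have hlp : Real.log p ≤ Real.log z := Real.log_le_log hp0 hpz
    have hl0 : 0 ≤ Real.log p := Real.log_nonneg hp1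
    set t := Real.log p / Real.log z with ht
    have ht0 : 0 ≤ t := by positivity
    have ht1 : t ≤ 1 := by rw [ht, div_le_one (by linarith)]; exact hlp
    have hc := convexOn_exp.2 (Set.mem_univ 0) (Set.mem_univ (η * Real.log z))
      (sub_nonneg.2 ht1) ht0 (by ring)
    simp only [smul_eq_mul, mul_zero, zero_add, Real.exp_zero, mul_one] at hc
    have he : t * (η * Real.log z) = Real.log p * η := by
      rw [ht]; field_simp
    rw [he, ← Real.rpow_def_of_pos hp0] at hc
    rw [sub_eq_add_neg, Real.rpow_add hp0, Real.rpow_neg_one]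
    have : (p : ℝ) ^ η ≤ 1 + t * E := by linarith
    calc (p : ℝ) ^ η * (p : ℝ)⁻¹ ≤ (1 + t * E) * (p : ℝ)⁻¹ := by gcongr
      _ = _ := by rw [ht]; ring
  rw [Finset.sum_add_distrib, ← Finset.mul_sum] at h1
  refine h1.trans (add_le_add le_rfl ?_)
  have hE0 : 0 ≤ E := (Real.exp_pos _).le
  calc E / Real.log z * ∑ p ∈ ⌊z⌋₊.primesLE, Real.log p / p
      ≤ E / Real.log z * (3 * Real.log z) := by
        gcongr; linarith [log_four_le]
    _ = 3 * E := by field_simp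

theorem isRFull_mul_iff {r m n : ℕ} (h : Nat.Coprime m n) :
    IsRFull r (m * n) ↔ IsRFull r m ∧ IsRFull r n := by
  constructor
  · intro H
    refine ⟨fun p hp hpm => ?_, fun p hp hpn => ?_⟩
    · exact ((h.coprime_dvd_left hpm).pow_left r).dvd_of_dvd_mul_right
        (H p hp (hpm.mul_right n))
    · exact ((h.symm.coprime_dvd_left hpn).pow_left r).dvd_of_dvd_mul_left
        (H p hp (hpn.mul_left m))
  · rintro ⟨hm, hn⟩ p hp hd
    rcases hp.dvd_mul.1 hd with hd | hd
    · exact (hm p hp hd).mul_right n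
    · exact (hn p hp hd).mul_left m

theorem isRFull_prime_pow_iff {r p k : ℕ} (hp : p.Prime) :
    IsRFull r (p ^ k) ↔ k = 0 ∨ r ≤ k := by
  constructor
  · intro H
    rcases Nat.eq_zero_or_pos k with hk | hk
    · exact Or.inl hk
    · exact Or.inr ((Nat.pow_dvd_pow_iff_le_right hp.one_lt).1
        (H p hp (dvd_pow_self p hk.ne')))
  · rintro (rfl | hk) q hq hd
    · exact absurd (by simpa using hd) hq.one_lt.ne'
    · obtain rfl := (Nat.prime_dvd_prime_iff_eq hq hp).1 (hq.dvd_of_dvd_pow hd)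
      exact pow_dvd_pow q hk

/-- The function `n ↦ n ^ (-σ)` supported on the `r`-full numbers. -/
def rfullWeight (r : ℕ) (σ : ℝ) (n : ℕ) : ℝ :=
  if IsRFull r n then (n : ℝ) ^ (-σ) else 0

theorem rfullWeight_nonneg (r : ℕ) (σ : ℝ) (n : ℕ) : 0 ≤ rfullWeight r σ n := by
  unfold rfullWeight
  split_ifs <;> positivity

theorem rfullWeight_one (r : ℕ) (σ : ℝ) : rfullWeight r σ 1 = 1 := by
  have : IsRFull r 1 := fun p hp h => absurd (by simpa using h) hp.one_lt.ne'
  simp [rfullWeight, this]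

theorem rfullWeight_mul (r : ℕ) (σ : ℝ) {m n : ℕ} (h : Nat.Coprime m n) :
    rfullWeight r σ (m * n) = rfullWeight r σ m * rfullWeight r σ n := by
  simp only [rfullWeight, isRFull_mul_iff h, Nat.cast_mul]
  rw [Real.mul_rpow (by positivity) (by positivity)]
  by_cases hm : IsRFull r m <;> by_cases hn : IsRFull r n <;> simp [hm, hn]

theorem rfullWeight_prime_pow {r p : ℕ} (σ : ℝ) (hp : p.Prime) (k : ℕ) :
    rfullWeight r σ (p ^ k) = if k = 0 ∨ r ≤ k then ((p : ℝ) ^ (-σ)) ^ k else 0 := by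
  simp only [rfullWeight, isRFull_prime_pow_iff hp]
  rw [Nat.cast_pow, ← Real.rpow_natCast, ← Real.rpow_natCast, ← Real.rpow_mul (by positivity),
    ← Real.rpow_mul (by positivity), mul_comm]

theorem hasSum_rfullWeight_prime_pow {r p : ℕ} (hr : 1 ≤ r) {σ : ℝ} (hσ : 0 < σ) (hp : p.Prime) :
    HasSum (fun k => rfullWeight r σ (p ^ k))
      (((p : ℝ) ^ (-σ)) ^ r / (1 - (p : ℝ) ^ (-σ)) + 1) := by
  have hq0 : 0 ≤ (p : ℝ) ^ (-σ) := by positivity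
  have hq1 : (p : ℝ) ^ (-σ) < 1 :=
    Real.rpow_lt_one_of_one_lt_of_neg (by exact_mod_cast hp.one_lt) (by linarith)
  have h1 : ∑ i ∈ Finset.range r, rfullWeight r σ (p ^ i) = 1 := by
    rw [Finset.sum_eq_single_of_mem 0 (Finset.mem_range.2 hr)]
    · simpa using rfullWeight_one r σ
    · intro i hi hi0
      rw [rfullWeight_prime_pow σ hp, if_neg]
      have := Finset.mem_range.1 hi
      omega
  have h2 := (hasSum_nat_add_iff (f := fun k => rfullWeight r σ (p ^ k))
    (g := ((p : ℝ) ^ (-σ)) ^ r / (1 - (p : ℝ) ^ (-σ))) r).1 ?_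
  · rwa [h1] at h2
  · have h3 := (hasSum_geometric_of_lt_one hq0 hq1).mul_left (((p : ℝ) ^ (-σ)) ^ r)
    rw [← div_eq_mul_inv] at h3
    refine h3.congr_fun fun k => ?_
    rw [rfullWeight_prime_pow σ hp, if_pos (Or.inr (Nat.le_add_left r k)), pow_add, mul_comm]

/-- Euler product bound for the sum of `n ^ (-σ)` over smooth `r`-full numbers. -/
theorem prod_tsum_rfullWeight_le {r : ℕ} (hr : 1 ≤ r) {σ σ₀ c : ℝ} (hσ₀ : 0 < σ₀) (hσ : σ₀ ≤ σ)
    (hc : 1 < c) (hcσ : c ≤ (r + 1) * σ) (N : ℕ) :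
    ∏ p ∈ N.primesLE, ∑' k : ℕ, rfullWeight r σ (p ^ k) ≤
      Real.exp (∑ p ∈ N.primesLE, (p : ℝ) ^ (-(r * σ)) +
        (1 - (2 : ℝ) ^ (-σ₀))⁻¹ * ∑' n : ℕ, (n : ℝ) ^ (-c)) := by
  have h2 : (2 : ℝ) ^ (-σ₀) < 1 :=
    Real.rpow_lt_one_of_one_lt_of_neg (by norm_num) (by linarith)
  have hfin : ∑ p ∈ N.primesLE, (p : ℝ) ^ (-c) ≤ ∑' n : ℕ, (n : ℝ) ^ (-c) :=
    (summable_natCast_rpow_neg hc).sum_le_tsum _ fun _ _ => by positivity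
  have hD : 0 ≤ (1 - (2 : ℝ) ^ (-σ₀))⁻¹ := inv_nonneg.2 (by linarith)
  calc ∏ p ∈ N.primesLE, ∑' k : ℕ, rfullWeight r σ (p ^ k)
      ≤ ∏ p ∈ N.primesLE,
        Real.exp ((p : ℝ) ^ (-(r * σ)) + (1 - (2 : ℝ) ^ (-σ₀))⁻¹ * (p : ℝ) ^ (-c)) := by
        refine Finset.prod_le_prod (fun p _ => tsum_nonneg fun k => rfullWeight_nonneg _ _ _)
          fun p hp => ?_
        have hp' : p.Prime := Nat.prime_of_mem_primesLE hp
        have hp1 : (1 : ℝ) < p := by exact_mod_cast hp'.one_lt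
        have hp2 : (2 : ℝ) ≤ p := by exact_mod_cast hp'.two_le
        rw [(hasSum_rfullWeight_prime_pow hr (hσ₀.trans_le hσ) hp').tsum_eq]
        refine le_trans ?_ (Real.add_one_le_exp _)
        have hpow : ∀ k : ℕ, ((p : ℝ) ^ (-σ)) ^ k = (p : ℝ) ^ (-(k * σ)) := by
          intro k
          rw [← Real.rpow_natCast, ← Real.rpow_mul (by positivity)]
          ring_nf
        have hq : (p : ℝ) ^ (-σ) ≤ (2 : ℝ) ^ (-σ₀) :=
          (Real.rpow_le_rpow_of_nonpos (by norm_num) hp2 (by linarith)).trans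
            (Real.rpow_le_rpow_of_exponent_le (by norm_num) (by linarith))
        have hsplit : ((p : ℝ) ^ (-σ)) ^ r / (1 - (p : ℝ) ^ (-σ)) =
            ((p : ℝ) ^ (-σ)) ^ r + (1 - (p : ℝ) ^ (-σ))⁻¹ * ((p : ℝ) ^ (-σ)) ^ (r + 1) := by
          have : 1 - (p : ℝ) ^ (-σ) ≠ 0 := by linarith
          field_simp
          ring
        rw [hsplit, hpow, hpow]
        have h3 : (p : ℝ) ^ (-(((r + 1 : ℕ) : ℝ) * σ)) ≤ (p : ℝ) ^ (-c) :=
          Real.rpow_le_rpow_of_exponent_le hp1.le (by push_cast; linarith)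
        have h4 : (1 - (p : ℝ) ^ (-σ))⁻¹ ≤ (1 - (2 : ℝ) ^ (-σ₀))⁻¹ :=
          inv_anti₀ (by linarith) (by linarith)
        gcongr
    _ = Real.exp (∑ p ∈ N.primesLE, (p : ℝ) ^ (-(r * σ)) +
        (1 - (2 : ℝ) ^ (-σ₀))⁻¹ * ∑ p ∈ N.primesLE, (p : ℝ) ^ (-c)) := by
        rw [← Real.exp_sum, Finset.sum_add_distrib, Finset.mul_sum]
    _ ≤ _ := by gcongr

theorem prime_dvd_le_Pj_one {n p : ℕ} (hn : n ≠ 0) (hp : p.Prime) (hd : p ∣ n) : p ≤ Pj 1 n := by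
  have hmem : p ∈ n.primeFactorsList := (Nat.mem_primeFactorsList hn).2 ⟨hp, hd⟩
  have hne : n.primeFactorsList ≠ [] := List.ne_nil_of_mem hmem
  have h1 : Pj 1 n = n.primeFactorsList.getLast hne := by
    rw [List.getLast_eq_head_reverse, Pj, Nat.sub_self,
      List.getD_eq_getElem _ _ (by simpa using List.length_pos_iff.2 hne),
      List.head_eq_getElem]
  rw [h1]
  exact (Nat.primeFactorsList_sorted n).pairwise.rel_getLast hmem

/-- Rankin's upper bound for the number of smooth `r`-full integers up to `X`. -/
theorem card_rfull_smooth_le {r : ℕ} (hr : 1 ≤ r) {σ X Z : ℝ} (hσ : 0 < σ) (hX : 0 < X) :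
    (Nat.card {n : ℕ | 1 ≤ n ∧ (n : ℝ) ≤ X ∧ (Pj 1 n : ℝ) ≤ Z ∧ IsRFull r n} : ℝ) ≤
      X ^ σ * ∏ p ∈ ⌊Z⌋₊.primesLE, ∑' k : ℕ, rfullWeight r σ (p ^ k) := by
  set S : Set ℕ := {n : ℕ | 1 ≤ n ∧ (n : ℝ) ≤ X ∧ (Pj 1 n : ℝ) ≤ Z ∧ IsRFull r n} with hS
  have hfin : S.Finite :=
    (Set.finite_Iic ⌊X⌋₊).subset fun n hn => Nat.le_floor hn.2.1
  have hE := EulerProduct.summable_and_hasSum_smoothNumbers_prod_primesBelow_tsum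
    (rfullWeight_one r σ) (fun {m n} h => rfullWeight_mul r σ h)
    (fun {p} hp => (hasSum_rfullWeight_prime_pow hr hσ hp).summable.norm) (⌊Z⌋₊ + 1)
  have hsub : ∀ n ∈ hfin.toFinset, n ∈ (⌊Z⌋₊ + 1).smoothNumbers := by
    intro n hn
    obtain ⟨h1, -, h3, -⟩ := hfin.mem_toFinset.1 hn
    refine Nat.mem_smoothNumbers'.2 fun p hp hd => Nat.lt_succ_of_le (Nat.le_floor ?_)
    exact (Nat.cast_le.2 (prime_dvd_le_Pj_one (by omega) hp hd)).trans h3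
  have hsum : ∑ n ∈ hfin.toFinset, rfullWeight r σ n ≤
      ∏ p ∈ ⌊Z⌋₊.primesLE, ∑' k : ℕ, rfullWeight r σ (p ^ k) := by
    rw [← Finset.sum_subtype_of_mem (rfullWeight r σ) hsub]
    exact sum_le_hasSum _ (fun n _ => rfullWeight_nonneg r σ n) hE.2
  rw [Nat.card_coe_set_eq, Set.ncard_eq_toFinset_card S hfin]
  calc (hfin.toFinset.card : ℝ) = ∑ n ∈ hfin.toFinset, 1 := by simp
    _ ≤ ∑ n ∈ hfin.toFinset, X ^ σ * rfullWeight r σ n := by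
      refine Finset.sum_le_sum fun n hn => ?_
      obtain ⟨h1, h2, -, h4⟩ := hfin.mem_toFinset.1 hn
      have hn0 : (0 : ℝ) < n := by exact_mod_cast h1
      rw [rfullWeight, if_pos h4, Real.rpow_neg hn0.le, ← div_eq_mul_inv,
        one_le_div (by positivity)]
      exact Real.rpow_le_rpow hn0.le h2 hσ.le
    _ ≤ _ := by
      rw [← Finset.mul_sum]
      exact mul_le_mul_of_nonneg_left hsum (by positivity)

theorem half_le_log_log_three_mul {u : ℝ} (hu : 2 ≤ u) :
    1 / 2 ≤ Real.log (Real.log (3 * u)) := by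
  have h2 := Real.log_two_gt_d9
  have h6 : 1.7 ≤ Real.log (3 * u) := by
    have h : 5 / 2 * Real.log 2 ≤ Real.log (3 * u) := by
      have h3 : Real.log ((2 : ℝ) ^ 5) ≤ Real.log ((3 * u) ^ 2) := by
        apply Real.log_le_log (by norm_num)
        nlinarith
      rw [Real.log_pow, Real.log_pow] at h3
      push_cast at h3
      linarith
    linarith
  rw [Real.le_log_iff_exp_le (by linarith)]
  have h : Real.exp (1 / 2) ^ 2 ≤ 1.7 ^ 2 := by
    rw [← Real.exp_nat_mul]
    norm_num
    linarith [Real.exp_one_lt_d9]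
  exact (le_of_sq_le_sq h (by norm_num)).trans h6

/-- The exponent of convergence left over after shifting by `1 / max 3 (2 r)`. -/
theorem one_lt_succ_mul_rankin_exponent {r : ℕ} (hr : 1 ≤ r) :
    1 < ((r : ℝ) + 1) * ((1 - 1 / ((max 3 (2 * r) : ℕ) : ℝ)) / r) := by
  rcases hr.eq_or_lt with rfl | hr2
  · norm_num
  · have h3 : (3 : ℕ) ≤ 2 * r := by omega
    have hr' : (2 : ℝ) ≤ r := by exact_mod_cast hr2
    rw [max_eq_right h3]
    push_cast
    have : ((r : ℝ) + 1) * ((1 - 1 / (2 * r)) / r) - 1 = (r - 1) / (2 * r ^ 2) := by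
      field_simp
      ring
    have : 0 < ((r : ℝ) - 1) / (2 * r ^ 2) := div_pos (by linarith) (by positivity)
    linarith

theorem rfull_smooth_count (r : ℕ) (hr : 1 ≤ r) :
    ∃ A : ℝ, 0 < A ∧ ∃ X₀ : ℝ, ∀ X : ℝ, X₀ ≤ X →
      ∀ Z : ℝ, Real.log X ^ (max 3 (2 * r)) ≤ Z → Z ≤ X ^ ((1 : ℝ) / 2) →
        (Nat.card {n : ℕ | 1 ≤ n ∧ (n : ℝ) ≤ X ∧ (Pj 1 n : ℝ) ≤ Z ∧ IsRFull r n} : ℝ) ≤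
          A * X ^ ((1 : ℝ) / (r : ℝ)) * Real.log Z *
            Real.exp (-(Real.log X / Real.log Z / (r : ℝ)) *
                Real.log (Real.log X / Real.log Z) +
              A * (Real.log X / Real.log Z) *
                Real.log (Real.log (3 * (Real.log X / Real.log Z)))) := by
  have hr0 : (0 : ℝ) < r := by exact_mod_cast hr
  set m : ℕ := max 3 (2 * r) with hm
  have hm3 : (3 : ℝ) ≤ m := by exact_mod_cast le_max_left 3 (2 * r)
  set σ₀ : ℝ := (1 - 1 / (m : ℝ)) / r with hσ₀def
  set c : ℝ := ((r : ℝ) + 1) * σ₀ with hcdef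
  have hc : 1 < c := one_lt_succ_mul_rankin_exponent hr
  have hσ₀ : 0 < σ₀ := by
    by_contra! h
    nlinarith
  set K : ℝ := (1 - (2 : ℝ) ^ (-σ₀))⁻¹ * ∑' n : ℕ, (n : ℝ) ^ (-c)
  set B : ℝ := 2 * Real.exp 3 * Real.exp K with hB
  have hB0 : 0 < B := by positivity
  refine ⟨B + 6, by positivity, Real.exp 3, fun X hX Z hZ₁ hZ₂ => ?_⟩
  have hX0 : 0 < X := (Real.exp_pos 3).trans_le hX
  have hlX : 3 ≤ Real.log X := (Real.le_log_iff_exp_le hX0).2 hX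
  have hZX : Real.log X ≤ Z :=
    (le_self_pow₀ (by linarith) (by omega)).trans hZ₁
  have hZ0 : 0 < Z := by linarith
  have hZe : Real.exp 1 ≤ Z := by linarith [Real.exp_one_lt_d9]
  have hlZ : 1 ≤ Real.log Z := (Real.le_log_iff_exp_le hZ0).2 hZe
  have hmll : m * Real.log (Real.log X) ≤ Real.log Z := by
    rw [← Real.log_pow]
    exact Real.log_le_log (by positivity) hZ₁
  set U : ℝ := Real.log X / Real.log Z with hU
  have hU2 : 2 ≤ U := by
    rw [hU, le_div_iff₀ (by linarith)]
    have := Real.log_le_log hZ0 hZ₂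
    rw [Real.log_rpow hX0] at this
    linarith
  have hUX : U ≤ Real.log X := div_le_self (by linarith) hlZ
  have hlU : Real.log U ≤ Real.log (Real.log X) := Real.log_le_log (by linarith) hUX
  set η : ℝ := Real.log U / Real.log Z with hη
  have hηm : η ≤ 1 / m := by
    rw [hη, div_le_div_iff₀ (by linarith) (by linarith)]
    nlinarith
  have hηZ : η * Real.log Z = Real.log U := by
    rw [hη]; field_simp
  set σ : ℝ := (1 - η) / r with hσdef
  have hσ : σ₀ ≤ σ := by
    rw [hσ₀def, hσdef]; gcongr
  have hrσ : -(r * σ) = η - 1 := by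
    rw [hσdef]; field_simp; ring
  have hcount := card_rfull_smooth_le (Z := Z) hr (hσ₀.trans_le hσ) hX0
  have hprod := prod_tsum_rfullWeight_le hr hσ₀ hσ hc
    (mul_le_mul_of_nonneg_left hσ (by positivity)) ⌊Z⌋₊
  rw [hrσ] at hprod
  have hshift := sum_primesLE_rpow_le (η := η) hZe
  rw [hηZ, Real.exp_log (by linarith)] at hshift
  have hmertens := exp_sum_primesLE_inv_le hZe
  have hXσ : X ^ σ = X ^ ((1 : ℝ) / r) * Real.exp (-(U / r) * Real.log U) := by
    rw [Real.rpow_def_of_pos hX0, Real.rpow_def_of_pos hX0, ← Real.exp_add]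
    congr 1
    rw [hσdef, hη, hU]
    field_simp
    ring
  have hbound : ∏ p ∈ ⌊Z⌋₊.primesLE, ∑' k : ℕ, rfullWeight r σ (p ^ k) ≤
      B * Real.log Z * Real.exp (3 * U) := by
    calc _ ≤ Real.exp (∑ p ∈ ⌊Z⌋₊.primesLE, (p : ℝ) ^ (η - 1) + K) := hprod
      _ ≤ Real.exp (∑ p ∈ ⌊Z⌋₊.primesLE, (p : ℝ)⁻¹ + 3 * U + K) := by gcongr
      _ = Real.exp (∑ p ∈ ⌊Z⌋₊.primesLE, (p : ℝ)⁻¹) * Real.exp (3 * U) * Real.exp K := by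
        rw [Real.exp_add, Real.exp_add]
      _ ≤ (2 * Real.exp 3 * Real.log Z) * Real.exp (3 * U) * Real.exp K := by gcongr
      _ = _ := by rw [hB]; ring
  have hll := half_le_log_log_three_mul hU2
  calc _ ≤ X ^ σ * ∏ p ∈ ⌊Z⌋₊.primesLE, ∑' k : ℕ, rfullWeight r σ (p ^ k) := hcount
    _ ≤ X ^ σ * (B * Real.log Z * Real.exp (3 * U)) := by gcongr
    _ = B * X ^ ((1 : ℝ) / r) * Real.log Z *
        Real.exp (-(U / r) * Real.log U + 3 * U) := by
      rw [hXσ, Real.exp_add]; ring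
    _ ≤ _ := by
      have h3 : 3 * U ≤ (B + 6) * U * Real.log (Real.log (3 * U)) := by
        have h6 : 6 * U ≤ (B + 6) * U := by gcongr; linarith
        calc 3 * U = 6 * U * (1 / 2) := by ring
          _ ≤ _ := by gcongr
      gcongr
      linarith
end
end

section
/- Let F_1,…,F_K ∈ ℤ[T] be nonconstant and multiplicatively independent. There exist constants C_1 = C_1(F_1,…,F_K) ∈ ℕ and A = A(F_1,…,F_K) > 0 such that: (1) for every prime ℓ, the number of tuples (A_1,…,A_K) ∈ {1,…,ℓ−1}^K for which the reduction of F_1^{A_1} ⋯ F_K^{A_K} modulo ℓ is of the form c·G(T)^{ℓ−1} for some c ∈ 𝔽_ℓ and G ∈ 𝔽_ℓ[T] is at most A; and (2) if moreover ℓ > C_1 and gcd(ℓ−1, β(F_1,…,F_K)) = 1, then the only such tuple is (ℓ−1, …, ℓ−1). -/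
open Polynomial
open scoped Classical

noncomputable section

/-- Two integer matrices are unimodularly equivalent. -/
def UnimodularEquiv {r c : ℕ} (A B : Matrix (Fin r) (Fin c) ℤ) : Prop :=
  ∃ (P : Matrix (Fin r) (Fin r) ℤ) (Q : Matrix (Fin c) (Fin c) ℤ),
    IsUnit P.det ∧ IsUnit Q.det ∧ P * A * Q = B

namespace UnimodularEquiv

variable {r c : ℕ} {A B D : Matrix (Fin r) (Fin c) ℤ}

theorem refl (A : Matrix (Fin r) (Fin c) ℤ) : UnimodularEquiv A A :=
  ⟨1, 1, by simp, by simp, by simp⟩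

theorem trans (h : UnimodularEquiv A B) (h' : UnimodularEquiv B D) : UnimodularEquiv A D := by
  obtain ⟨P, Q, hP, hQ, rfl⟩ := h
  obtain ⟨P', Q', hP', hQ', rfl⟩ := h'
  refine ⟨P' * P, Q * Q', ?_, ?_, by simp only [Matrix.mul_assoc]⟩
  · rw [Matrix.det_mul]; exact hP'.mul hP
  · rw [Matrix.det_mul]; exact hQ.mul hQ'

theorem transpose (h : UnimodularEquiv A B) :
    UnimodularEquiv A.transpose B.transpose := by
  obtain ⟨P, Q, hP, hQ, rfl⟩ := h
  refine ⟨Q.transpose, P.transpose, by rwa [Matrix.det_transpose], by rwa [Matrix.det_transpose],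
    ?_⟩
  simp only [Matrix.transpose_mul, Matrix.mul_assoc]

theorem mul_left {P : Matrix (Fin r) (Fin r) ℤ} (hP : IsUnit P.det)
    (A : Matrix (Fin r) (Fin c) ℤ) : UnimodularEquiv A (P * A) :=
  ⟨P, 1, hP, by simp, by simp⟩

theorem submatrix (σ : Equiv.Perm (Fin r)) (τ : Equiv.Perm (Fin c))
    (A : Matrix (Fin r) (Fin c) ℤ) : UnimodularEquiv A (A.submatrix σ τ) := by
  refine ⟨(1 : Matrix (Fin r) (Fin r) ℤ).submatrix σ id,
    (1 : Matrix (Fin c) (Fin c) ℤ).submatrix id τ, ?_, ?_, ?_⟩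
  · rw [Matrix.det_permute]
    simp
  · rw [Matrix.det_permute']
    simp
  · ext i j
    simp [Matrix.mul_apply, Matrix.one_apply]

end UnimodularEquiv

/-- The integer `d` is a nonzero entry of least absolute value among all the entries of matrices
equivalent to `A`. -/
def IsMinimalEntry {r c : ℕ} (A : Matrix (Fin r) (Fin c) ℤ) (d : ℤ) : Prop :=
  ∀ B, UnimodularEquiv A B → ∀ i j, B i j ≠ 0 → d.natAbs ≤ (B i j).natAbs

theorem IsMinimalEntry.transpose {r c : ℕ} {A : Matrix (Fin r) (Fin c) ℤ} {d : ℤ}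
    (h : IsMinimalEntry A d) : IsMinimalEntry A.transpose d := fun B hB i j hij =>
  h B.transpose (by simpa using hB.transpose) j i hij

theorem IsMinimalEntry.dvd_col {r c : ℕ} {A B : Matrix (Fin (r + 1)) (Fin (c + 1)) ℤ}
    (h : IsMinimalEntry A (B 0 0)) (h0 : B 0 0 ≠ 0) (hB : UnimodularEquiv A B)
    (i : Fin (r + 1)) : B 0 0 ∣ B i 0 := by
  rcases eq_or_ne i 0 with rfl | hi
  · exact dvd_rfl
  by_contra hd
  have hmod : B i 0 % B 0 0 ≠ 0 := fun hz => hd (Int.dvd_of_emod_eq_zero hz)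
  have hval : (Matrix.transvection i 0 (-(B i 0 / B 0 0)) * B) i 0 = B i 0 % B 0 0 := by
    rw [Matrix.transvection_mul_apply_same, Int.emod_def]
    ring
  have := h _ (hB.trans (.mul_left (P := Matrix.transvection i 0 (-(B i 0 / B 0 0)))
    (by simp [Matrix.det_transvection_of_ne _ _ hi]) B)) i 0 (by rwa [hval])
  rw [hval] at this
  have h1 := Int.emod_nonneg (B i 0) h0
  have h2 := Int.emod_lt_abs (B i 0) h0
  rw [Int.abs_eq_natAbs] at h2
  omega

theorem IsMinimalEntry.dvd_row {r c : ℕ} {A B : Matrix (Fin (r + 1)) (Fin (c + 1)) ℤ}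
    (h : IsMinimalEntry A (B 0 0)) (h0 : B 0 0 ≠ 0) (hB : UnimodularEquiv A B)
    (j : Fin (c + 1)) : B 0 0 ∣ B 0 j :=
  IsMinimalEntry.dvd_col (A := A.transpose) (B := B.transpose) h.transpose h0 hB.transpose j

/-- Clearing the first column below a pivot that divides it, without changing the first row. -/
theorem exists_unimodularEquiv_col_eq_zero {r c : ℕ} (B : Matrix (Fin (r + 1)) (Fin (c + 1)) ℤ)
    (h : ∀ i, B 0 0 ∣ B i 0) :
    ∃ D, UnimodularEquiv B D ∧ (∀ j, D 0 j = B 0 j) ∧ ∀ i, i ≠ 0 → D i 0 = 0 := by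
  choose q hq using h
  set v : Fin (r + 1) → ℤ := fun i => if i = 0 then 1 else -q i with hv
  set P := (1 : Matrix (Fin (r + 1)) (Fin (r + 1)) ℤ).updateCol 0 v with hP
  have hdet : P.det = 1 := by
    rw [hP, ← Matrix.cramer_apply, Matrix.cramer_one]
    simp [hv]
  have happ : ∀ i j, i ≠ 0 → (P * B) i j = B i j - q i * B 0 j := by
    intro i j hi
    obtain ⟨i, rfl⟩ := Fin.exists_succ_eq.mpr hi
    simp [hP, hv, Matrix.mul_apply, Fin.sum_univ_succ, Matrix.one_apply, Matrix.updateCol_apply,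
      Fin.succ_ne_zero]
    ring
  refine ⟨P * B, .mul_left (by simp [hdet]) B, fun j => ?_, fun i hi => ?_⟩
  · simp [hP, hv, Matrix.mul_apply, Fin.sum_univ_succ, Matrix.one_apply, Matrix.updateCol_apply,
      Fin.succ_ne_zero, (Fin.succ_ne_zero _).symm]
  · rw [happ i 0 hi, hq i]
    ring

theorem exists_unimodularEquiv_pivot {r c : ℕ} (A : Matrix (Fin (r + 1)) (Fin (c + 1)) ℤ)
    (hA : A ≠ 0) :
    ∃ B, UnimodularEquiv A B ∧ (∀ i, i ≠ 0 → B i 0 = 0) ∧ (∀ j, j ≠ 0 → B 0 j = 0) ∧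
      ∀ i j, B 0 0 ∣ B i j := by
  have hex : ∃ n : ℕ, ∃ B, UnimodularEquiv A B ∧ ∃ i j, B i j ≠ 0 ∧ (B i j).natAbs = n := by
    by_contra hne
    push Not at hne
    exact hA (by
      ext i j
      by_contra hij
      exact hne _ A (.refl A) i j hij rfl)
  obtain ⟨B, hB, i, j, hij, hn⟩ := Nat.find_spec hex
  set B₁ := B.submatrix (Equiv.swap 0 i) (Equiv.swap 0 j) with hB₁
  have h00 : B₁ 0 0 = B i j := by simp [hB₁]
  have hAB₁ : UnimodularEquiv A B₁ := hB.trans (.submatrix _ _ B)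
  have hmin : IsMinimalEntry A (B i j) := fun D hD k l hkl => by
    rw [hn]
    exact Nat.find_min' hex ⟨D, hD, k, l, hkl, rfl⟩
  obtain ⟨B₂, hB₂, hrow₂, hcol₂⟩ := exists_unimodularEquiv_col_eq_zero B₁
    (IsMinimalEntry.dvd_col (h00 ▸ hmin) (h00 ▸ hij) hAB₁)
  have hAB₂ := hAB₁.trans hB₂
  have h₂ : B₂ 0 0 = B i j := (hrow₂ 0).trans h00
  obtain ⟨B₃, hB₃, hrow₃, hcol₃⟩ := exists_unimodularEquiv_col_eq_zero B₂.transpose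
    (IsMinimalEntry.dvd_row (h₂ ▸ hmin) (h₂ ▸ hij) hAB₂)
  have hAB₃ : UnimodularEquiv A B₃.transpose := hAB₂.trans (by simpa using hB₃.transpose)
  have h₃ : B₃ 0 0 = B i j := (hrow₃ 0).trans h₂
  have hcol : ∀ k, k ≠ 0 → B₃ 0 k = 0 := fun k hk => (hrow₃ k).trans (hcol₂ k hk)
  refine ⟨B₃.transpose, hAB₃, hcol, hcol₃, fun k l => ?_⟩
  rcases eq_or_ne k 0 with rfl | hk
  · exact IsMinimalEntry.dvd_row (A := A) (by simpa [h₃] using hmin) (by simpa [h₃] using hij)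
      hAB₃ l
  have hD := hAB₃.trans (.mul_left (P := Matrix.transvection 0 k 1)
    (by simp [Matrix.det_transvection_of_ne _ _ hk.symm]) _)
  have hD0 : (Matrix.transvection 0 k (1 : ℤ) * B₃.transpose) 0 0 = B i j := by
    simp [hcol k hk, h₃]
  have := IsMinimalEntry.dvd_row (by rwa [hD0]) (by rwa [hD0]) hD l
  rw [hD0, Matrix.transvection_mul_apply_same, one_mul] at this
  have h' := IsMinimalEntry.dvd_row (A := A) (by simpa [h₃] using hmin) (by simpa [h₃] using hij)
      hAB₃ l
  rw [Matrix.transpose_apply, h₃] at h' ⊢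
  exact (dvd_add_right h').1 this

/-- The block diagonal matrix with blocks `d` and `A`. -/
def consDiagonal {r c : ℕ} (d : ℤ) (A : Matrix (Fin r) (Fin c) ℤ) :
    Matrix (Fin (r + 1)) (Fin (c + 1)) ℤ :=
  Matrix.of (Fin.cons (Fin.cons d 0) fun i => Fin.cons 0 (A i))

section consDiagonal

variable {r c : ℕ} (d : ℤ) (A : Matrix (Fin r) (Fin c) ℤ)

@[simp] theorem consDiagonal_zero_zero : consDiagonal d A 0 0 = d := rfl

@[simp] theorem consDiagonal_zero_succ (j : Fin c) : consDiagonal d A 0 j.succ = 0 := rfl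

@[simp] theorem consDiagonal_succ_zero (i : Fin r) : consDiagonal d A i.succ 0 = 0 := rfl

@[simp] theorem consDiagonal_succ_succ (i : Fin r) (j : Fin c) :
    consDiagonal d A i.succ j.succ = A i j := rfl

theorem consDiagonal_mul {s : ℕ} (e : ℤ) (B : Matrix (Fin c) (Fin s) ℤ) :
    consDiagonal d A * consDiagonal e B = consDiagonal (d * e) (A * B) := by
  ext i j
  refine Fin.cases ?_ (fun i => ?_) i <;> refine Fin.cases ?_ (fun j => ?_) j <;>
    simp [Matrix.mul_apply, Fin.sum_univ_succ]

theorem det_consDiagonal (A : Matrix (Fin r) (Fin r) ℤ) :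
    (consDiagonal d A).det = d * A.det := by
  rw [Matrix.det_succ_row_zero, Fin.sum_univ_succ]
  simp only [Fin.val_zero, pow_zero, consDiagonal_zero_zero, one_mul, consDiagonal_zero_succ,
    mul_zero, zero_mul, Finset.sum_const_zero, add_zero]
  rfl

theorem UnimodularEquiv.consDiagonal {A B : Matrix (Fin r) (Fin c) ℤ}
    (h : UnimodularEquiv A B) :
    UnimodularEquiv (consDiagonal d A) (consDiagonal d B) := by
  obtain ⟨P, Q, hP, hQ, rfl⟩ := h
  exact ⟨_root_.consDiagonal 1 P, _root_.consDiagonal 1 Q, by simpa [det_consDiagonal],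
    by simpa [det_consDiagonal], by simp [consDiagonal_mul]⟩

end consDiagonal

/-- Divisibility of all entries is preserved by unimodular equivalence. -/
theorem UnimodularEquiv.dvd {r c : ℕ} {A B : Matrix (Fin r) (Fin c) ℤ}
    (h : UnimodularEquiv A B) {d : ℤ} (hd : ∀ i j, d ∣ A i j) (i : Fin r) (j : Fin c) :
    d ∣ B i j := by
  obtain ⟨P, Q, -, -, rfl⟩ := h
  simp only [Matrix.mul_apply]
  exact Finset.dvd_sum fun k _ =>
    (Finset.dvd_sum fun l _ => (hd l k).mul_left (P i l)).mul_right (Q k j)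

/-- Existence of the Smith normal form over `ℤ`. -/
theorem exists_smith_normal_form {r c : ℕ} (A : Matrix (Fin r) (Fin c) ℤ) :
    ∃ D, UnimodularEquiv A D ∧
      (∀ (s : Fin r) (t : Fin c), (s : ℕ) ≠ (t : ℕ) → D s t = 0) ∧
      (∀ (s s' : Fin r) (t t' : Fin c), (s : ℕ) = (t : ℕ) → (s' : ℕ) = (t' : ℕ) →
        (s : ℕ) + 1 = (s' : ℕ) → D s t ∣ D s' t') := by
  induction r generalizing c with
  | zero => exact ⟨A, .refl A, fun s => s.elim0, fun s => s.elim0⟩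
  | succ r ih =>
    cases c with
    | zero => exact ⟨A, .refl A, fun _ t => t.elim0, fun _ _ t => t.elim0⟩
    | succ c =>
      by_cases hA : A = 0
      · exact ⟨A, .refl A, fun s t _ => by simp [hA], fun s s' t t' _ _ _ => by simp [hA]⟩
      obtain ⟨B, hAB, hcol, hrow, hdvd⟩ := exists_unimodularEquiv_pivot A hA
      have hBcons : B = consDiagonal (B 0 0) (B.submatrix Fin.succ Fin.succ) := by
        ext i j
        refine Fin.cases ?_ (fun i => ?_) i <;> refine Fin.cases ?_ (fun j => ?_) j <;>
          simp [hcol, hrow, Fin.succ_ne_zero]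
      obtain ⟨D, hD, hdiag, hchain⟩ := ih (B.submatrix Fin.succ Fin.succ)
      have hBD : UnimodularEquiv B (consDiagonal (B 0 0) D) := by
        conv_lhs => rw [hBcons]
        exact hD.consDiagonal _
      refine ⟨_, hAB.trans hBD, fun s t => ?_, fun s s' t t' => ?_⟩
      · refine Fin.cases ?_ (fun i => ?_) s <;> refine Fin.cases ?_ (fun j => ?_) t
        · simp
        · simp
        · simp
        · simpa using hdiag i j
      · intro hst hst' hss'
        obtain ⟨u, rfl⟩ : ∃ u, Fin.succ u = s' :=
          Fin.exists_succ_eq.mpr fun h => by simp [h] at hss'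
        obtain ⟨v, rfl⟩ : ∃ v, Fin.succ v = t' :=
          Fin.exists_succ_eq.mpr fun h => by simp [h] at hst'
        rcases Fin.eq_zero_or_eq_succ s with rfl | ⟨i, rfl⟩
        · obtain rfl : t = 0 := Fin.ext hst.symm
          exact hBD.dvd hdvd _ _
        · obtain ⟨j, rfl⟩ : ∃ j, Fin.succ j = t :=
            Fin.exists_succ_eq.mpr fun h => by simp [h] at hst
          simp only [Fin.val_succ, add_left_inj] at hst hst' hss'
          exact hchain i u j v hst hst' hss'

theorem zpow_sum_eq_prod_zpow {ι K : Type*} [Field K] {a : K} (ha : a ≠ 0) (s : Finset ι)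
    (f : ι → ℤ) : a ^ (∑ i ∈ s, f i) = ∏ i ∈ s, a ^ f i := by
  classical
  induction s using Finset.induction_on with
  | empty => simp
  | insert i s hi ih => rw [Finset.sum_insert hi, Finset.prod_insert hi, zpow_add₀ ha, ih]

theorem exists_primitive_irreducible_factorization {m : ℕ} (F : Fin m → ℤ[X])
    (hF : ∀ i, F i ≠ 0) :
    ∃ (M : ℕ) (G : Fin M → ℤ[X]) (c : Fin m → ℤ) (μ : Fin M → Fin m → ℕ),
      (∀ j, Irreducible (G j)) ∧ (∀ j, (G j).IsPrimitive) ∧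
      (∀ j j', j ≠ j' → ¬ Associated (G j) (G j')) ∧
      (∀ i, F i = C (c i) * ∏ j, G j ^ μ j i) ∧
      (∀ j, ∃ i, 0 < μ j i) ∧ ∀ i, c i ≠ 0 := by
  classical
  set s : Fin m → Multiset ℤ[X] := fun i =>
    UniqueFactorizationMonoid.normalizedFactors (F i).primPart with hs
  set S : Finset ℤ[X] := Finset.univ.biUnion fun i => (s i).toFinset with hS
  have hprim0 : ∀ i, (F i).primPart ≠ 0 := fun i => (F i).primPart_ne_zero
  have hmem : ∀ p ∈ S, ∃ i, p ∈ s i := fun p hp => by simpa [hS] using hp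
  have hfac : ∀ i, ∃ d : ℤ, F i = C d * (s i).prod := fun i => by
    obtain ⟨u, hu⟩ := UniqueFactorizationMonoid.prod_normalizedFactors (hprim0 i)
    obtain ⟨v, -, hv⟩ := Polynomial.isUnit_iff.mp u.isUnit
    refine ⟨(F i).content * v, ?_⟩
    conv_lhs => rw [(F i).eq_C_content_mul_primPart, ← hu, ← hv]
    rw [C_mul]
    ring
  choose d hd using hfac
  set e := S.equivFin with he
  refine ⟨S.card, fun j => (e.symm j : ℤ[X]), d,
    fun j i => (s i).count (e.symm j : ℤ[X]), fun j => ?_, fun j => ?_, fun j j' hjj' hass => ?_,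
    fun i => ?_, fun j => ?_, fun i hi => ?_⟩
  · obtain ⟨i, hi⟩ := hmem _ (e.symm j).2
    exact UniqueFactorizationMonoid.irreducible_of_normalized_factor _ hi
  · obtain ⟨i, hi⟩ := hmem _ (e.symm j).2
    exact isPrimitive_of_dvd (F i).isPrimitive_primPart
      (UniqueFactorizationMonoid.dvd_of_mem_normalizedFactors hi)
  · obtain ⟨i, hi⟩ := hmem _ (e.symm j).2
    obtain ⟨i', hi'⟩ := hmem _ (e.symm j').2
    refine hjj' (e.symm.injective (Subtype.ext ?_))
    have h1 := UniqueFactorizationMonoid.normalize_normalized_factor _ hi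
    have h2 := UniqueFactorizationMonoid.normalize_normalized_factor _ hi'
    rw [← h1, ← h2]
    exact normalize_eq_normalize_iff_associated.mpr hass
  · have hsub : (s i).toFinset ⊆ S :=
      Finset.subset_biUnion_of_mem (fun i => (s i).toFinset) (Finset.mem_univ i)
    conv_lhs => rw [hd i, Finset.prod_multiset_count_of_subset _ _ hsub]
    congr 1
    rw [← Finset.prod_coe_sort]
    exact (Equiv.prod_comp e.symm fun p : S => (p : ℤ[X]) ^ (s i).count (p : ℤ[X])).symm
  · obtain ⟨i, hi⟩ := hmem _ (e.symm j).2
    exact ⟨i, Multiset.count_pos.mpr hi⟩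
  · exact hF i (by rw [hd i, hi]; simp)

theorem MultIndep.mulVec_eq_zero {m M : ℕ} {F : Fin m → ℤ[X]} (hMI : MultIndep F)
    {G : Fin M → ℤ[X]} {c : Fin m → ℤ} {μ : Fin M → Fin m → ℕ}
    (hG : ∀ j, G j ≠ 0) (hF : ∀ i, F i = C (c i) * ∏ j, G j ^ μ j i)
    (x : Fin m → ℤ) (hx : (Matrix.of fun u v => (μ u v : ℤ)).mulVec x = 0) : x = 0 := by
  by_contra hx0
  refine hMI ⟨x, hx0, ∏ i, (c i : ℚ) ^ x i, ?_⟩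
  set φ : ℤ[X] →+* RatFunc ℚ :=
    (algebraMap ℚ[X] (RatFunc ℚ)).comp (mapRingHom (Int.castRingHom ℚ)) with hφ
  have hφ0 : ∀ j, φ (G j) ≠ 0 := fun j h => by
    rw [hφ, RingHom.comp_apply, map_eq_zero_iff _ (RatFunc.algebraMap_injective ℚ),
      coe_mapRingHom, Polynomial.map_eq_zero_iff Int.cast_injective] at h
    exact hG j h
  have hφC : ∀ z : ℤ, φ (C z) = algebraMap ℚ (RatFunc ℚ) z := fun z => by simp [hφ]
  have key : ∀ i, φ (F i) ^ x i =
      algebraMap ℚ (RatFunc ℚ) ((c i : ℚ) ^ x i) * ∏ j, φ (G j) ^ ((μ j i : ℤ) * x i) := fun i => by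
    rw [hF i, map_mul, map_prod, mul_zpow, hφC, map_zpow₀, ← Finset.prod_zpow]
    congr 1
    refine Finset.prod_congr rfl fun j _ => ?_
    rw [map_pow, zpow_mul, zpow_natCast]
  calc _ = ∏ i, φ (F i) ^ x i := rfl
    _ = _ := by
      simp only [key, Finset.prod_mul_distrib]
      rw [Finset.prod_comm, ← map_prod]
      convert mul_one _
      refine Finset.prod_eq_one fun j _ => ?_
      have hj := congrFun hx j
      simp only [Matrix.mulVec, dotProduct, Matrix.of_apply, Pi.zero_apply] at hj
      rw [← zpow_zero (φ (G j)), ← hj]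
      exact (zpow_sum_eq_prod_zpow (hφ0 j) _ _).symm

theorem exists_smith_normal_form_of_injective {m M : ℕ} (hm : 1 ≤ m) (E : Matrix (Fin M) (Fin m) ℤ)
    (hE : ∀ x, E.mulVec x = 0 → x = 0) :
    ∃ (β : ℤ) (P : Matrix (Fin M) (Fin M) ℤ) (Q : Matrix (Fin m) (Fin m) ℤ),
      IsUnit P.det ∧ IsUnit Q.det ∧
      (∀ (s : Fin M) (t : Fin m), (s : ℕ) ≠ (t : ℕ) → (P * E * Q) s t = 0) ∧
      (∀ (s s' : Fin M) (t t' : Fin m), (s : ℕ) = (t : ℕ) → (s' : ℕ) = (t' : ℕ) →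
        (s : ℕ) + 1 = (s' : ℕ) → (P * E * Q) s t ∣ (P * E * Q) s' t') ∧
      (∀ (s : Fin M) (t : Fin m), (s : ℕ) = (t : ℕ) → (s : ℕ) + 1 = min M m →
        β = (P * E * Q) s t) ∧
      β ≠ 0 ∧
      ∀ (n : ℤ) (x : Fin m → ℤ), (∀ j, n ∣ E.mulVec x j) → ∀ i, n ∣ β * x i := by
  obtain ⟨D, ⟨P, Q, hP, hQ, rfl⟩, hdiag, hchain⟩ := exists_smith_normal_form E
  set D := P * E * Q with hD
  have hcol : ∀ t : Fin m, ∃ s : Fin M, (s : ℕ) = t ∧ D s t ≠ 0 := fun t => by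
    by_contra! hne
    have hz : ∀ s, D s t = 0 := fun s => by
      by_cases hst : (s : ℕ) = t
      · exact hne s hst
      · exact hdiag s t hst
    have h1 : P.mulVec (E.mulVec (Q.mulVec (Pi.single t 1))) = 0 := by
      rw [Matrix.mulVec_mulVec, Matrix.mulVec_mulVec, ← hD, Matrix.mulVec_single_one]
      exact funext hz
    have h2 := hE _ (Matrix.mulVec_injective_of_isUnit ((P.isUnit_iff_isUnit_det).mpr hP)
      (h1.trans (Matrix.mulVec_zero P).symm))
    have h3 := congrFun (Matrix.mulVec_injective_of_isUnit ((Q.isUnit_iff_isUnit_det).mpr hQ)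
      (h2.trans (Matrix.mulVec_zero Q).symm)) t
    simp at h3
  obtain ⟨k, rfl⟩ : ∃ k, m = k + 1 := ⟨m - 1, by omega⟩
  obtain ⟨s₀, hs₀, hβ⟩ := hcol (Fin.last k)
  have hMm : min M (k + 1) = k + 1 := by
    have := s₀.2
    rw [hs₀] at this
    simp at this
    omega
  have hdvd : ∀ (n : ℕ) (s : Fin M) (t : Fin (k + 1)), (s : ℕ) = t → (t : ℕ) + n = k →
      D s t ∣ D s₀ (Fin.last k) := by
    intro n
    induction n with
    | zero =>
      intro s t hst htk
      have ht : t = Fin.last k := Fin.ext (by simpa using htk)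
      have hs : s = s₀ := Fin.ext (by rw [hst, hs₀, ht])
      rw [ht, hs]
    | succ n ih =>
      intro s t hst htk
      set t' : Fin (k + 1) := ⟨t + 1, by omega⟩
      obtain ⟨s', hs', -⟩ := hcol t'
      exact (hchain s s' t t' hst hs' (by rw [hs', hst])).trans
        (ih s' t' hs' (by change (t : ℕ) + 1 + n = k; omega))
  refine ⟨D s₀ (Fin.last k), P, Q, hP, hQ, hdiag, hchain, fun s t hst hs => ?_, hβ,
    fun n x hx i => ?_⟩
  · rw [hMm] at hs
    congr 1
    · exact Fin.ext (by rw [hs₀]; simp; omega)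
    · exact Fin.ext (by simp; omega)
  set y := Q⁻¹.mulVec x with hy
  have hxy : x = Q.mulVec y := by
    rw [hy, Matrix.mulVec_mulVec, Matrix.mul_nonsing_inv _ hQ, Matrix.one_mulVec]
  have hDy : ∀ s, n ∣ D.mulVec y s := fun s => by
    have : D.mulVec y = P.mulVec (E.mulVec x) := by
      rw [hD, ← Matrix.mulVec_mulVec, ← hxy, Matrix.mulVec_mulVec]
    rw [this]
    change n ∣ ∑ j, P s j * E.mulVec x j
    exact Finset.dvd_sum fun j _ => (hx j).mul_left _
  have hny : ∀ t, n ∣ D s₀ (Fin.last k) * y t := fun t => by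
    obtain ⟨s, hst, -⟩ := hcol t
    have h1 : D.mulVec y s = D s t * y t := by
      refine Finset.sum_eq_single t (fun t' _ ht' => ?_) (fun h => absurd (Finset.mem_univ t) h)
      exact mul_eq_zero_of_left (hdiag s t' fun h => ht' (Fin.ext (h.symm.trans hst))) _
    exact (h1 ▸ hDy s).trans (mul_dvd_mul_right (hdvd (k - t) s t hst (by omega)) _)
  rw [hxy]
  change n ∣ _ * ∑ t, Q i t * y t
  rw [Finset.mul_sum]
  exact Finset.dvd_sum fun t _ => by
    rw [mul_left_comm]
    exact (hny t).mul_left _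

theorem exists_isCoprime_map_zmod {f g : ℤ[X]}
    (h : IsCoprime (f.map (Int.castRingHom ℚ)) (g.map (Int.castRingHom ℚ))) :
    ∃ N : ℕ, ∀ ℓ : ℕ, ℓ.Prime → N < ℓ →
      IsCoprime (f.map (Int.castRingHom (ZMod ℓ))) (g.map (Int.castRingHom (ZMod ℓ))) := by
  obtain ⟨a, b, hab⟩ := h
  obtain ⟨d, hd0, hd⟩ := IsLocalization.integerNormalization_spec (nonZeroDivisors ℤ) a
  obtain ⟨e, he0, he⟩ := IsLocalization.integerNormalization_spec (nonZeroDivisors ℤ) b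
  set a' := IsLocalization.integerNormalization (nonZeroDivisors ℤ) a
  set b' := IsLocalization.integerNormalization (nonZeroDivisors ℤ) b
  have hde : d * e ≠ 0 := mul_ne_zero (nonZeroDivisors.ne_zero hd0) (nonZeroDivisors.ne_zero he0)
  have hd' : a'.map (Int.castRingHom ℚ) = C (d : ℚ) * a := by
    refine hd.trans ?_
    ext i
    simp
  have he' : b'.map (Int.castRingHom ℚ) = C (e : ℚ) * b := by
    refine he.trans ?_
    ext i
    simp
  have key : C e * a' * f + C d * b' * g = C (d * e) := by
    apply Polynomial.map_injective (Int.castRingHom ℚ) Int.cast_injective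
    simp only [Polynomial.map_add, Polynomial.map_mul, map_C, hd', he',
      eq_intCast (Int.castRingHom ℚ), C_mul]
    linear_combination (C (d : ℚ) * C (e : ℚ)) * hab
  refine ⟨(d * e).natAbs, fun ℓ hℓ hlt => ?_⟩
  have := Fact.mk hℓ
  have hne : ((d * e : ℤ) : ZMod ℓ) ≠ 0 := fun h0 => by
    rw [ZMod.intCast_zmod_eq_zero_iff_dvd] at h0
    have := Int.natAbs_le_of_dvd_ne_zero h0 hde
    simp only [Int.natAbs_natCast] at this
    omega
  have hkey := congrArg (Polynomial.map (Int.castRingHom (ZMod ℓ))) key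
  simp only [Polynomial.map_add, Polynomial.map_mul, map_C,
    eq_intCast (Int.castRingHom (ZMod ℓ))] at hkey
  have hunit : C (((d * e : ℤ) : ZMod ℓ)⁻¹) * C ((d * e : ℤ) : ZMod ℓ) = 1 := by
    rw [← C_mul, inv_mul_cancel₀ hne, C_1]
  refine ⟨C (((d * e : ℤ) : ZMod ℓ)⁻¹) * (C (e : ZMod ℓ) * a'.map (Int.castRingHom (ZMod ℓ))),
    C (((d * e : ℤ) : ZMod ℓ)⁻¹) * (C (d : ZMod ℓ) * b'.map (Int.castRingHom (ZMod ℓ))), ?_⟩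
  linear_combination C (((d * e : ℤ) : ZMod ℓ)⁻¹) * hkey + hunit

theorem exists_good_reduction {M : ℕ} (G : Fin M → ℤ[X]) (hirr : ∀ j, Irreducible (G j))
    (hprim : ∀ j, (G j).IsPrimitive) (hass : ∀ j j', j ≠ j' → ¬ Associated (G j) (G j')) :
    ∃ N : ℕ, ∀ ℓ : ℕ, ℓ.Prime → N < ℓ →
      (∀ j, 0 < ((G j).map (Int.castRingHom (ZMod ℓ))).natDegree) ∧
      (∀ j, ((G j).map (Int.castRingHom (ZMod ℓ))).Separable) ∧
      ∀ j j', j ≠ j' → IsCoprime ((G j).map (Int.castRingHom (ZMod ℓ)))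
        ((G j').map (Int.castRingHom (ZMod ℓ))) := by
  have hirrQ : ∀ j, Irreducible ((G j).map (Int.castRingHom ℚ)) := fun j =>
    (IsPrimitive.Int.irreducible_iff_irreducible_map_cast (hprim j)).mp (hirr j)
  have hsep : ∀ j, ∃ N : ℕ, ∀ ℓ : ℕ, ℓ.Prime → N < ℓ →
      ((G j).map (Int.castRingHom (ZMod ℓ))).Separable := fun j => by
    have h := (hirrQ j).separable
    rw [Polynomial.Separable, derivative_map] at h
    simpa only [Polynomial.Separable, derivative_map] using exists_isCoprime_map_zmod h
  have hcop : ∀ j j', ∃ N : ℕ, j ≠ j' → ∀ ℓ : ℕ, ℓ.Prime → N < ℓ →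
      IsCoprime ((G j).map (Int.castRingHom (ZMod ℓ)))
        ((G j').map (Int.castRingHom (ZMod ℓ))) := fun j j' => by
    by_cases hjj' : j = j'
    · exact ⟨0, fun h => absurd hjj' h⟩
    have h : IsCoprime ((G j).map (Int.castRingHom ℚ)) ((G j').map (Int.castRingHom ℚ)) := by
      refine ((hirrQ j).coprime_iff_not_dvd).mpr fun hdvd => hass j j' hjj' ?_
      rw [← IsPrimitive.Int.dvd_iff_map_cast_dvd_map_cast _ _ (hprim j)] at hdvd
      exact (hirr j).associated_of_dvd (hirr j') hdvd
    obtain ⟨N, hN⟩ := exists_isCoprime_map_zmod h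
    exact ⟨N, fun _ => hN⟩
  choose N₁ hN₁ using hsep
  choose N₂ hN₂ using hcop
  refine ⟨(∑ j, N₁ j) + (∑ j, ∑ j', N₂ j j') + ∑ j, (G j).leadingCoeff.natAbs,
    fun ℓ hℓ hlt => ⟨fun j => ?_, fun j => hN₁ j ℓ hℓ ?_, fun j j' hjj' => hN₂ j j' hjj' ℓ hℓ ?_⟩⟩
  · have hle : (G j).leadingCoeff.natAbs ≤ ∑ j, (G j).leadingCoeff.natAbs :=
      Finset.single_le_sum (f := fun j => (G j).leadingCoeff.natAbs) (fun _ _ => Nat.zero_le _)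
        (Finset.mem_univ j)
    rw [natDegree_map_of_leadingCoeff_ne_zero]
    · refine Nat.pos_of_ne_zero fun h0 => (hirr j).not_isUnit ?_
      obtain ⟨z, hz⟩ := natDegree_eq_zero.mp h0
      rw [← hz]
      exact isUnit_C.mpr (hprim j z (by rw [hz]))
    · intro h0
      rw [eq_intCast, ZMod.intCast_zmod_eq_zero_iff_dvd] at h0
      have := Int.natAbs_le_of_dvd_ne_zero h0 (by simpa using (hirr j).ne_zero)
      simp at this
      omega
  · have hle : N₁ j ≤ ∑ j, N₁ j := Finset.single_le_sum (fun _ _ => Nat.zero_le _)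
        (Finset.mem_univ j)
    omega
  · have hle : N₂ j j' ≤ ∑ j', N₂ j j' := Finset.single_le_sum (fun _ _ => Nat.zero_le _)
        (Finset.mem_univ j')
    have hle' : ∑ j', N₂ j j' ≤ ∑ j, ∑ j', N₂ j j' :=
      Finset.single_le_sum (f := fun j => ∑ j', N₂ j j') (fun _ _ => Nat.zero_le _)
        (Finset.mem_univ j)
    omega

theorem dvd_exponent_of_prod_pow_eq {K : Type*} [Field K] {M n : ℕ} {g : Fin M → K[X]}
    (hdeg : ∀ j, 0 < (g j).natDegree) (hsep : ∀ j, (g j).Separable)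
    (hcop : ∀ j j', j ≠ j' → IsCoprime (g j) (g j')) {a c : K} (ha : a ≠ 0) {e : Fin M → ℕ}
    {h : K[X]} (heq : C a * ∏ j, g j ^ e j = C c * h ^ n) (j : Fin M) : n ∣ e j := by
  have hg0 : ∀ j, g j ≠ 0 := fun j h0 => by simpa [h0] using hdeg j
  obtain ⟨p, hp, hpg⟩ := exists_irreducible_of_natDegree_pos (hdeg j)
  have hprod0 : C a * ∏ j, g j ^ e j ≠ 0 :=
    mul_ne_zero (C_ne_zero.mpr ha) (Finset.prod_ne_zero_iff.mpr fun j _ => pow_ne_zero _ (hg0 j))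
  have hc : c ≠ 0 := fun h0 => hprod0 (by rw [heq, h0, C_0, zero_mul])
  have hC : ∀ b : K, b ≠ 0 → emultiplicity p (C b) = 0 := fun b hb =>
    emultiplicity_eq_zero.mpr fun hd =>
      hp.not_isUnit (isUnit_of_dvd_unit hd (isUnit_C.mpr hb.isUnit))
  have hj : emultiplicity p (g j) = 1 := by
    have h1 : emultiplicity p (g j) ≤ 1 :=
      (squarefree_iff_emultiplicity_le_one (g j)).mp (hsep j).squarefree p |>.resolve_right
        hp.not_isUnit
    refine le_antisymm h1 ?_
    exact_mod_cast le_emultiplicity_of_pow_dvd (k := 1) (by simpa using hpg)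
  have hne : ∀ j', j' ≠ j → emultiplicity p (g j') = 0 := fun j' hj' =>
    emultiplicity_eq_zero.mpr fun hd =>
      hp.not_isUnit ((hcop j' j hj').isUnit_of_dvd' hd hpg)
  have hmul := congrArg (emultiplicity p) heq
  rw [emultiplicity_mul hp.prime, emultiplicity_mul hp.prime, hC a ha, hC c hc, zero_add, zero_add,
    Finset.emultiplicity_prod hp.prime, emultiplicity_pow hp.prime,
    Finset.sum_eq_single j (fun j' _ hj' => by rw [emultiplicity_pow hp.prime, hne j' hj', mul_zero])
      (by simp), emultiplicity_pow hp.prime, hj, mul_one] at hmul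
  rcases Nat.eq_zero_or_pos n with rfl | hn
  · have : e j = 0 := by simpa using hmul
    simp [this]
  have hfin : emultiplicity p h ≠ ⊤ := fun ht => by
    rw [ht] at hmul
    rw [ENat.mul_top (by exact_mod_cast hn.ne')] at hmul
    exact ENat.natCast_ne_top _ hmul
  obtain ⟨k, hk⟩ := ENat.ne_top_iff_exists.mp hfin
  rw [← hk] at hmul
  exact ⟨k, by exact_mod_cast hmul⟩

theorem card_filter_dvd_mul_le {n : ℕ} {b : ℕ} (hb : b ≠ 0) :
    (Finset.filter (fun x => n ∣ b * x) (Finset.Icc 1 n)).card ≤ b := by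
  have h : (Finset.Icc 1 b).card = b := by simp
  refine le_trans (Finset.card_le_card_of_injOn (fun x => b * x / n) (fun x hx => ?_)
    fun x hx y hy hxy => ?_) h.le
  · simp only [Finset.coe_filter, Finset.mem_Icc, Set.mem_ofPred_eq] at hx
    obtain ⟨⟨hx1, hxn⟩, k, hk⟩ := hx
    have hn : 0 < n := by omega
    simp only [hk, Nat.mul_div_cancel_left k hn, Finset.coe_Icc, Set.mem_Icc]
    constructor
    · refine Nat.pos_of_ne_zero fun h0 => ?_
      rw [h0, mul_zero] at hk
      exact (Nat.mul_pos (Nat.pos_of_ne_zero hb) hx1).ne' hk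
    · have := Nat.mul_le_mul_left b hxn
      rw [hk, mul_comm] at this
      exact Nat.le_of_mul_le_mul_right this hn
  · simp only [Finset.coe_filter, Finset.mem_Icc, Set.mem_ofPred_eq] at hx hy
    have := congrArg (· * n) hxy
    simp only [Nat.div_mul_cancel hx.2, Nat.div_mul_cancel hy.2] at this
    exact Nat.eq_of_mul_eq_mul_left (Nat.pos_of_ne_zero hb) this

theorem card_subtype_le_pow {m k : ℕ} {p : (Fin m → ℕ) → Prop} (S : Finset ℕ) (hS : S.card ≤ k)
    (h : ∀ t, p t → ∀ i, t i ∈ S) : Nat.card {t : Fin m → ℕ // p t} ≤ k ^ m := by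
  have hsub : {t | p t} ⊆ (Fintype.piFinset fun _ : Fin m => S : Set (Fin m → ℕ)) :=
    fun t ht => by simpa using h t ht
  calc Nat.card {t : Fin m → ℕ // p t} ≤ Nat.card (Fintype.piFinset fun _ : Fin m => S) :=
        Nat.card_mono (Finset.finite_toSet _) hsub
    _ = S.card ^ m := by rw [Nat.card_eq_fintype_card, Fintype.card_coe]; simp
    _ ≤ k ^ m := Nat.pow_le_pow_left hS m

/-- For all large primes `ℓ`, the exponent tuples giving `(ℓ - 1)`-th powers up to constants are
annihilated modulo `ℓ - 1` by the last invariant factor. -/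
theorem exists_lastInvFactor_dvd {m : ℕ} (hm : 1 ≤ m) {F : Fin m → ℤ[X]}
    (hF : ∀ i, F i ≠ 0) (hMI : MultIndep F) :
    ∃ (β : ℤ) (N : ℕ), IsLastInvFactor F β ∧ β ≠ 0 ∧ ∀ ℓ : ℕ, ℓ.Prime → N < ℓ →
      ∀ (t : Fin m → ℕ) (n : ℕ) (c : ZMod ℓ) (g : (ZMod ℓ)[X]),
        (∏ i, ((F i).map (Int.castRingHom (ZMod ℓ))) ^ t i) = C c * g ^ n →
        ∀ i, (n : ℤ) ∣ β * t i := by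
  obtain ⟨M, G, c, μ, hirr, hprim, hass, hfac, hpos, hc⟩ :=
    exists_primitive_irreducible_factorization F hF
  obtain ⟨β, P, Q, hP, hQ, hdiag, hchain, hβ, hβ0, hdvd⟩ :=
    exists_smith_normal_form_of_injective hm (Matrix.of fun u v => (μ u v : ℤ))
      (hMI.mulVec_eq_zero (fun j => (hirr j).ne_zero) hfac)
  obtain ⟨N, hN⟩ := exists_good_reduction G hirr hprim hass
  refine ⟨β, N + ∑ i, (c i).natAbs, ⟨M, G, c, μ, hirr, hprim, hass, hfac, hpos, P, Q, hP, hQ,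
    hdiag, hchain, hβ⟩, hβ0, fun ℓ hℓ hlt t n b g heq => hdvd n (fun i => t i) fun j => ?_⟩
  have := Fact.mk hℓ
  obtain ⟨hdeg, hsep, hcop⟩ := hN ℓ hℓ (by omega)
  have hcℓ : ∀ i, (c i : ZMod ℓ) ≠ 0 := fun i h0 => by
    rw [ZMod.intCast_zmod_eq_zero_iff_dvd] at h0
    have h1 := Int.natAbs_le_of_dvd_ne_zero h0 (hc i)
    have h2 : (c i).natAbs ≤ ∑ i, (c i).natAbs :=
      Finset.single_le_sum (f := fun i => (c i).natAbs) (fun _ _ => Nat.zero_le _)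
        (Finset.mem_univ i)
    simp only [Int.natAbs_natCast] at h1
    omega
  have hprod : (∏ i, ((F i).map (Int.castRingHom (ZMod ℓ))) ^ t i) =
      C (∏ i, (c i : ZMod ℓ) ^ t i) *
        ∏ j, (G j).map (Int.castRingHom (ZMod ℓ)) ^ ∑ i, μ j i * t i := by
    simp only [← Finset.prod_pow_eq_pow_sum]
    rw [Finset.prod_comm, map_prod, ← Finset.prod_mul_distrib]
    refine Finset.prod_congr rfl fun i _ => ?_
    rw [hfac i, Polynomial.map_mul, map_C, mul_pow, C_pow, Polynomial.map_prod, ← Finset.prod_pow,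
      eq_intCast]
    simp only [Polynomial.map_pow, pow_mul]
  have := dvd_exponent_of_prod_pow_eq hdeg hsep hcop
    (Finset.prod_ne_zero_iff.mpr fun i _ => pow_ne_zero (t i) (hcℓ i)) (hprod.symm.trans heq) j
  have h' := Int.natCast_dvd_natCast.mpr this
  simpa [Matrix.mulVec, dotProduct] using h'

theorem perfect_power_products_count
    (m : ℕ) (hm : 1 ≤ m)
    (F : Fin m → Polynomial ℤ)
    (hFnc : ∀ i, 0 < (F i).natDegree)
    (hMI : MultIndep F) :
    ∃ (C₁ A : ℕ), 0 < C₁ ∧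
      (∀ ℓ : ℕ, ℓ.Prime →
        Nat.card {t : Fin m → ℕ //
          (∀ i, 1 ≤ t i ∧ t i ≤ ℓ - 1) ∧
          ∃ (c : ZMod ℓ) (g : Polynomial (ZMod ℓ)),
            (∏ i, ((F i).map (Int.castRingHom (ZMod ℓ))) ^ t i) =
              Polynomial.C c * g ^ (ℓ - 1)} ≤ A) ∧
      (∀ ℓ : ℕ, ℓ.Prime → C₁ < ℓ →
        (∀ β : ℤ, IsLastInvFactor F β → Int.gcd ((ℓ : ℤ) - 1) β = 1) →
        ∀ t : Fin m → ℕ,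
          ((∀ i, 1 ≤ t i ∧ t i ≤ ℓ - 1) ∧
            ∃ (c : ZMod ℓ) (g : Polynomial (ZMod ℓ)),
              (∏ i, ((F i).map (Int.castRingHom (ZMod ℓ))) ^ t i) =
                Polynomial.C c * g ^ (ℓ - 1)) →
          t = fun _ => ℓ - 1) := by
  obtain ⟨β, N, hβ, hβ0, hdvd⟩ := exists_lastInvFactor_dvd hm
    (fun i h0 => by simpa [h0] using hFnc i) hMI
  refine ⟨N + 1, (N + 1) ^ m + β.natAbs ^ m, N.succ_pos, fun ℓ hℓ => ?_,
    fun ℓ hℓ hlt hgcd t ⟨ht, c, g, heq⟩ => ?_⟩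
  · rcases le_or_gt ℓ N with hle | hlt
    · refine le_add_right (card_subtype_le_pow (Finset.Icc 1 (ℓ - 1)) (by simp; omega) ?_)
      exact fun t ht i => Finset.mem_Icc.mpr (ht.1 i)
    · refine le_add_left (card_subtype_le_pow _
        (card_filter_dvd_mul_le (n := ℓ - 1) (Int.natAbs_ne_zero.mpr hβ0)) ?_)
      rintro t ⟨ht, c, g, heq⟩ i
      refine Finset.mem_filter.mpr ⟨Finset.mem_Icc.mpr (ht i), ?_⟩
      simpa [Int.natAbs_mul] using Int.natAbs_dvd_natAbs.mpr (hdvd ℓ hℓ hlt t (ℓ - 1) c g heq i)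
  · funext i
    have h := hdvd ℓ hℓ (by omega) t (ℓ - 1) c g heq i
    have hg := hgcd β hβ
    rw [← Nat.cast_pred hℓ.pos] at hg
    have hd := Int.natCast_dvd_natCast.mp (Int.dvd_of_dvd_mul_right_of_gcd_one h hg)
    exact le_antisymm (ht i).2 (Nat.le_of_dvd (ht i).1 hd)
end
end
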